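/- arXiv:1808.02871 — 2 statements merged into one kernel-verified Lean document; each statement's English description precedes it below -/
import Mathlib

section
/- Let N ≥ 3 and let d_0, …, d_{3^N−1} ∈ ℝ^N be the rows of the semi-lexicographic perturbation matrix D_N. Then for all pairwise distinct coordinate indices i, j, k in {1,…,N}, ∑_{m=0}^{3^N−1} d_m^i · d_m^j · d_m^k = 0. -/
open Matrix Finset

/-- The semi-lexicographic perturbation matrix `D_N`, given entrywise:
`Dlex N m i` is the entry of `D_N` in row `m ∈ {0,…,3^N−1}` and column `i ∈ {0,…,N−1}`
(0-indexed).  `D_1` is the column `(−1,−1,2)ᵀ`; the first column of `D_{k+1}` consists of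
`2·3^k` entries equal to `−1` followed by `3^k` entries equal to `2`, and for `i ≥ 1` the
`i`-th column of `D_{k+1}` is the `(i−1)`-th column of `D_k` stacked vertically three times. -/
def Dlex : ℕ → ℕ → ℕ → ℝ
  | 0, _, _ => 0
  | (N + 1), m, 0 => if m < 2 * 3 ^ N then -1 else 2
  | (N + 1), m, (i + 1) => Dlex N (m % 3 ^ N) i

/-- A sum over `3 * n` consecutive integers, split into three blocks of length `n`. -/
theorem sum_range_three_mul {M : Type*} [AddCommMonoid M] (n : ℕ) (f : ℕ → M) :
    ∑ m ∈ Finset.range (3 * n), f m =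
      ∑ r ∈ Finset.range n, (f r + f (n + r) + f (2 * n + r)) := by
  rw [show 3 * n = n + n + n by ring, Finset.sum_range_add, Finset.sum_range_add,
    Finset.sum_add_distrib, Finset.sum_add_distrib, two_mul]

/-- The first column of `D_{N+1}` is orthogonal to every vector of period `3 ^ N`. -/
theorem sum_Dlex_succ_zero_mul (N : ℕ) (f : ℕ → ℝ) :
    ∑ m ∈ Finset.range (3 ^ (N + 1)), Dlex (N + 1) m 0 * f (m % 3 ^ N) = 0 := by
  rw [pow_succ', sum_range_three_mul]
  refine Finset.sum_eq_zero fun r hr => ?_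
  have hr : r < 3 ^ N := Finset.mem_range.mp hr
  have h₀ : r < 2 * 3 ^ N := by omega
  have h₁ : 3 ^ N + r < 2 * 3 ^ N := by omega
  have h₂ : ¬ 2 * 3 ^ N + r < 2 * 3 ^ N := by omega
  simp only [Dlex, if_pos h₀, if_pos h₁, if_neg h₂, Nat.add_mod_left, Nat.mul_add_mod_self_right,
    Nat.mod_eq_of_lt hr]
  ring

/-- Summing a function of period `3 ^ N` over `3 ^ (N + 1)` terms gives three times its sum over
one period. -/
theorem sum_range_mod_three_pow (N : ℕ) (f : ℕ → ℝ) :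
    ∑ m ∈ Finset.range (3 ^ (N + 1)), f (m % 3 ^ N) = 3 * ∑ m ∈ Finset.range (3 ^ N), f m := by
  rw [pow_succ', sum_range_three_mul, Finset.mul_sum]
  refine Finset.sum_congr rfl fun r hr => ?_
  simp only [Nat.add_mod_left, Nat.mul_add_mod_self_right,
    Nat.mod_eq_of_lt (Finset.mem_range.mp hr)]
  ring

/-- Three pairwise distinct columns of `D_N` have vanishing triple product sum, for every `N`. -/
theorem sum_Dlex_mul_mul_eq_zero (N i j k : ℕ) (hij : i ≠ j) (hik : i ≠ k) (hjk : j ≠ k) :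
    ∑ m ∈ Finset.range (3 ^ N), Dlex N m i * Dlex N m j * Dlex N m k = 0 := by
  induction N generalizing i j k with
  | zero => simp [Dlex]
  | succ N ih =>
    rcases i with _ | i
    · obtain ⟨j, rfl⟩ := Nat.exists_eq_succ_of_ne_zero hij.symm
      obtain ⟨k, rfl⟩ := Nat.exists_eq_succ_of_ne_zero hik.symm
      rw [← sum_Dlex_succ_zero_mul N fun r => Dlex N r j * Dlex N r k]
      exact Finset.sum_congr rfl fun m _ => mul_assoc _ _ _
    rcases j with _ | j
    · obtain ⟨k, rfl⟩ := Nat.exists_eq_succ_of_ne_zero hjk.symm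
      rw [← sum_Dlex_succ_zero_mul N fun r => Dlex N r i * Dlex N r k]
      exact Finset.sum_congr rfl fun m _ => by simp only [Dlex]; ring
    rcases k with _ | k
    · rw [← sum_Dlex_succ_zero_mul N fun r => Dlex N r i * Dlex N r j]
      exact Finset.sum_congr rfl fun m _ => mul_comm _ _
    · have h := sum_range_mod_three_pow N fun r => Dlex N r i * Dlex N r j * Dlex N r k
      rw [ih i j k (by omega) (by omega) (by omega), mul_zero] at h
      exact h

/-- For `N ≥ 3` and pairwise distinct coordinate indices `i, j, k`, the rows
of the semi-lexicographic perturbation matrix `D_N` satisfy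
`∑ m, Dlex N m i * Dlex N m j * Dlex N m k = 0`. -/
theorem lex_matrix_triple_product_sum_zero (N : ℕ) (hN : 3 ≤ N) (i j k : ℕ)
    (hi : i < N) (hj : j < N) (hk : k < N)
    (hij : i ≠ j) (hik : i ≠ k) (hjk : j ≠ k) :
    (∑ m ∈ Finset.range (3 ^ N), Dlex N m i * Dlex N m j * Dlex N m k) = 0 := by
  exact sum_Dlex_mul_mul_eq_zero N i j k hij hik hjk
end

section
/- Let N ≥ 1, let d_0, …, d_{3^N−1} ∈ ℝ^N be the rows of the semi-lexicographic perturbation matrix D_N, and let f : ℝ^N → ℝ be three times continuously differentiable with all third-order partial derivatives bounded in absolute value by α₀ > 0. Fix x ∈ ℝ^N and δ > 0. On a probability space, let ξ_m⁺, ξ_m⁻ (m = 0,…,3^N−1) be integrable real random variables with E[ξ_m⁺ − ξ_m⁻] = 0 for every m, and define the 1RDSA-Lex-DP gradient estimate ĝ = (1/(2·3^N)) ∑_{m=0}^{3^N−1} d_m · (f(x + δ d_m) + ξ_m⁺ − f(x − δ d_m) − ξ_m⁻)/(2δ). Then for every coordinate i ∈ {1,…,N}, | E[ĝ_i] − ∂_i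 f(x) | ≤ C₀ δ², where C₀ = α₀ N³ 3^{N−1}. -/
open Finset MeasureTheory

theorem sum_range_three_mul_s9 (K : ℕ) (F : ℕ → ℝ) :
    ∑ m ∈ range (3 * K), F m = ∑ m ∈ range K, (F m + F (K + m) + F (2 * K + m)) := by
  rw [show 3 * K = 2 * K + K by ring, sum_range_add, show range (2 * K) = range (K + K) by
    rw [two_mul], sum_range_add, sum_add_distrib, sum_add_distrib]

theorem Dlex_eq_neg_one_or_two {N i : ℕ} (m : ℕ) (hi : i < N) :
    Dlex N m i = -1 ∨ Dlex N m i = 2 := by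
  induction N generalizing m i with
  | zero => omega
  | succ N ih =>
    cases i with
    | zero => simp only [Dlex]; split_ifs <;> simp
    | succ i => exact ih _ (by omega)

/-- A row of `D_{N+1}` splits into one of three blocks according to its first entry. -/
theorem sum_range_Dlex_succ (N : ℕ) (G : ℝ → ℕ → ℝ) :
    ∑ m ∈ range (3 ^ (N + 1)), G (Dlex (N + 1) m 0) (m % 3 ^ N) =
      ∑ m ∈ range (3 ^ N), (2 * G (-1) m + G 2 m) := by
  rw [pow_succ', sum_range_three_mul_s9]
  refine sum_congr rfl fun m hm => ?_
  have hm' := mem_range.1 hm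
  have h1 : m < 2 * 3 ^ N := by omega
  have h2 : 3 ^ N + m < 2 * 3 ^ N := by omega
  have h3 : ¬ 2 * 3 ^ N + m < 2 * 3 ^ N := by omega
  simp only [Dlex, h1, h2, h3, if_true, if_false, Nat.add_mod_left, Nat.mul_add_mod_self_right,
    Nat.mod_eq_of_lt hm']
  ring

theorem sum_Dlex {N i : ℕ} (hi : i < N) : ∑ m ∈ range (3 ^ N), Dlex N m i = 0 := by
  induction N generalizing i with
  | zero => omega
  | succ N ih =>
    cases i with
    | zero => rw [sum_range_Dlex_succ N fun a _ => a]; norm_num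
    | succ i =>
      have h := sum_range_Dlex_succ N fun _ m => Dlex N m i
      simp only [← mul_sum, sum_add_distrib, ih (Nat.lt_of_succ_lt_succ hi)] at h
      simpa [Dlex] using h

theorem sum_Dlex_mul_Dlex {N i j : ℕ} (hi : i < N) (hj : j < N) :
    ∑ m ∈ range (3 ^ N), Dlex N m i * Dlex N m j = if i = j then 2 * 3 ^ N else 0 := by
  induction N generalizing i j with
  | zero => omega
  | succ N ih =>
    cases i with
    | zero =>
      cases j with
      | zero =>
        rw [sum_range_Dlex_succ N fun a _ => a * a, sum_const, card_range]
        simp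
        ring
      | succ j =>
        have h := sum_range_Dlex_succ N fun a m => a * Dlex N m j
        simp only [sum_add_distrib, ← mul_sum, sum_Dlex (Nat.lt_of_succ_lt_succ hj)] at h
        simpa [Dlex] using h
    | succ i =>
      cases j with
      | zero =>
        have h := sum_range_Dlex_succ N fun a m => Dlex N m i * a
        simp only [sum_add_distrib, ← mul_sum, ← sum_mul,
          sum_Dlex (Nat.lt_of_succ_lt_succ hi)] at h
        simpa [Dlex] using h
      | succ j =>
        have h := sum_range_Dlex_succ N fun _ m => Dlex N m i * Dlex N m j
        simp only [sum_add_distrib, ← mul_sum,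
          ih (Nat.lt_of_succ_lt_succ hi) (Nat.lt_of_succ_lt_succ hj)] at h
        refine h.trans ?_
        simp only [Nat.succ_inj]
        split_ifs <;> ring

theorem abs_Dlex_le {N i : ℕ} (m : ℕ) (hi : i < N) : |Dlex N m i| ≤ 2 := by
  rcases Dlex_eq_neg_one_or_two m hi with h | h <;> norm_num [h]

theorem sum_abs_Dlex {N i : ℕ} (hi : i < N) :
    ∑ m ∈ range (3 ^ N), |Dlex N m i| = 4 / 3 * 3 ^ N := by
  have h (m : ℕ) : |Dlex N m i| = (Dlex N m i * Dlex N m i + 2) / 3 := by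
    rcases Dlex_eq_neg_one_or_two m hi with h | h <;> norm_num [h]
  simp_rw [h, ← sum_div, sum_add_distrib, sum_Dlex_mul_Dlex hi hi]
  simp
  ring

theorem sum_Dlex_smul_map {N : ℕ} (L : (Fin N → ℝ) →L[ℝ] ℝ) (i : Fin N) :
    ∑ m ∈ range (3 ^ N), L (fun j : Fin N => Dlex N m j) * Dlex N m i =
      2 * 3 ^ N * L (Pi.single i 1) := by
  have h (m : ℕ) : L (fun j : Fin N => Dlex N m j) =
      ∑ j : Fin N, Dlex N m j * L (Pi.single j 1) := by
    conv_lhs => rw [pi_eq_sum_univ' (fun j : Fin N => Dlex N m j)]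
    simp [Pi.single]
  simp_rw [h, sum_mul]
  rw [sum_comm]
  have h' (j : Fin N) : ∑ m ∈ range (3 ^ N), Dlex N m j * L (Pi.single j 1) * Dlex N m i =
      L (Pi.single j 1) * if j = i then 2 * 3 ^ N else 0 := by
    have := sum_Dlex_mul_Dlex j.2 i.2
    simp only [Fin.val_inj] at this
    rw [← this, mul_sum]
    exact sum_congr rfl fun m _ => by ring
  simp_rw [h']
  simp [mul_comm]

theorem iteratedDeriv_comp_line {E : Type*} [NormedAddCommGroup E] [NormedSpace ℝ E]
    {f : E → ℝ} {n : ℕ} (hf : ContDiff ℝ n f) (x d : E) (t : ℝ) :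
    iteratedDeriv n (fun s : ℝ => f (x + s • d)) t =
      iteratedFDeriv ℝ n f (x + t • d) fun _ => d := by
  have hf' : ContDiff ℝ n fun z => f (x + z) := hf.comp (by fun_prop)
  have h := (ContinuousLinearMap.toSpanSingleton ℝ d).iteratedFDeriv_comp_right hf' t le_rfl
  rw [iteratedFDeriv_comp_add_left] at h
  have h' := congrArg (fun A => A fun _ => (1 : ℝ)) h
  simpa [Function.comp_def, iteratedDeriv] using h'

/-- A third-order estimate of the error of a symmetric difference quotient. -/
theorem abs_symm_diff_sub_le {g : ℝ → ℝ} (hg : ContDiff ℝ 3 g) {M : ℝ}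
    (hM : ∀ t, |iteratedDeriv 3 g t| ≤ M) {δ : ℝ} (hδ : 0 < δ) :
    |g δ - g (-δ) - 2 * δ * deriv g 0| ≤ M * δ ^ 3 / 3 := by
  set h : ℝ → ℝ := fun t => g t - g (-t) with hh
  have hgn : ContDiff ℝ 3 fun t => g (-t) := hg.comp contDiff_neg
  have hc : ContDiff ℝ 3 h := hg.sub hgn
  have hd (k : ℕ) (hk : k ≤ 3) (t : ℝ) :
      iteratedDeriv k h t = iteratedDeriv k g t - (-1) ^ k * iteratedDeriv k g (-t) := by
    have hk' : (k : WithTop ℕ∞) ≤ 3 := by exact_mod_cast hk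
    rw [hh, iteratedDeriv_fun_sub (hg.of_le hk').contDiffAt (hgn.of_le hk').contDiffAt,
      iteratedDeriv_comp_neg, smul_eq_mul]
  obtain ⟨c, -, hc'⟩ := taylor_mean_remainder_lagrange_iteratedDeriv (n := 2) hδ.ne
    (hc.contDiffOn.of_le (by norm_num))
  have hw (k : ℕ) (hk : k ≤ 3) :
      iteratedDerivWithin k h (Set.uIcc 0 δ) 0 = iteratedDeriv k h 0 :=
    iteratedDerivWithin_eq_iteratedDeriv (uniqueDiffOn_uIcc hδ.ne)
      (hc.of_le (by exact_mod_cast hk)).contDiffAt Set.left_mem_uIcc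
  have h0 : h 0 = 0 := by simp [hh]
  rw [taylorWithinEval_succ, taylorWithinEval_succ, taylor_within_zero_eval, hw 1 (by norm_num),
    hw 2 (by norm_num), hd 1 (by norm_num), hd 2 (by norm_num), hd 3 (by norm_num), h0,
    iteratedDeriv_one] at hc'
  have e : g δ - g (-δ) - 2 * δ * deriv g 0 =
      (iteratedDeriv 3 g c + iteratedDeriv 3 g (-c)) * δ ^ 3 / 6 := by
    norm_num [Nat.factorial, hh] at hc'
    linear_combination hc'
  rw [e, abs_div, abs_mul, abs_of_pos (pow_pos hδ 3), abs_of_pos (by norm_num : (0 : ℝ) < 6)]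
  have := (abs_add_le _ _).trans (add_le_add (hM c) (hM (-c)))
  have := mul_le_mul_of_nonneg_right this (pow_pos hδ 3).le
  linarith

theorem abs_multilinear_diag_le {ι : Type*} [Fintype ι] [DecidableEq ι] {n : ℕ}
    (A : ContinuousMultilinearMap ℝ (fun _ : Fin n => ι → ℝ) ℝ) {α : ℝ}
    (hA : ∀ r : Fin n → ι, |A fun k => Pi.single (r k) 1| ≤ α) (d : ι → ℝ) :
    |A fun _ => d| ≤ α * (∑ j, |d j|) ^ n := by
  have hd : d = ∑ j, d j • (Pi.single j 1 : ι → ℝ) := by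
    conv_lhs => rw [pi_eq_sum_univ' d]
  have e : (A fun _ => d) = ∑ r : Fin n → ι, (∏ k, d (r k)) * A fun k => Pi.single (r k) 1 := by
    conv_lhs => rw [hd, A.map_sum]
    simp_rw [A.map_smul_univ, smul_eq_mul]
  rw [e, Fintype.sum_pow, mul_sum]
  refine (abs_sum_le_sum_abs _ _).trans (sum_le_sum fun r _ => ?_)
  rw [abs_mul, abs_prod, mul_comm]
  exact mul_le_mul_of_nonneg_right (hA r) (prod_nonneg fun _ _ => abs_nonneg _)

/-- The central difference along `d` approximates the directional derivative to second order. -/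
theorem abs_central_diff_sub_fderiv_le {N : ℕ} {f : (Fin N → ℝ) → ℝ} {α₀ : ℝ}
    (hf : ContDiff ℝ 3 f)
    (hbound : ∀ (x : Fin N → ℝ) (i j k : Fin N),
      |iteratedFDeriv ℝ 3 f x ![Pi.single i 1, Pi.single j 1, Pi.single k 1]| ≤ α₀)
    (x d : Fin N → ℝ) {δ : ℝ} (hδ : 0 < δ) :
    |(f (x + δ • d) - f (x - δ • d)) / (2 * δ) - fderiv ℝ f x d| ≤
      α₀ * (∑ j, |d j|) ^ 3 * δ ^ 2 / 6 := by
  have hg : ContDiff ℝ 3 fun t : ℝ => f (x + t • d) := hf.comp (by fun_prop)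
  have hM (t : ℝ) : |iteratedDeriv 3 (fun s : ℝ => f (x + s • d)) t| ≤
      α₀ * (∑ j, |d j|) ^ 3 := by
    rw [iteratedDeriv_comp_line (by exact_mod_cast hf)]
    refine abs_multilinear_diag_le _ (fun r => ?_) d
    convert hbound (x + t • d) (r 0) (r 1) (r 2) using 3
    ext k
    fin_cases k <;> rfl
  have h := abs_symm_diff_sub_le hg hM hδ
  have hderiv : deriv (fun t : ℝ => f (x + t • d)) 0 = fderiv ℝ f x d := by
    have := iteratedDeriv_comp_line (n := 1) (hf.of_le (by norm_num)) x d 0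
    simpa using this
  simp only [hderiv, neg_smul, ← sub_eq_add_neg] at h
  have e : (f (x + δ • d) - f (x - δ • d)) / (2 * δ) - fderiv ℝ f x d =
      (f (x + δ • d) - f (x - δ • d) - 2 * δ * fderiv ℝ f x d) / (2 * δ) := by
    field_simp
  rw [e, abs_div, abs_of_pos (by positivity : 0 < 2 * δ), div_le_iff₀ (by positivity)]
  linarith

/-- Asymptotic unbiasedness of the 1RDSA-Lex-DP gradient estimate: with
perturbations given by the rows `d_m` of the semi-lexicographic matrix `D_N`, zero-mean
integrable measurement noises `ξ_m⁺, ξ_m⁻`, and `f` three times continuously differentiable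
with third-order partials bounded by `α₀`, the gradient estimate
`ĝ = (1/(2·3^N)) ∑_m d_m (f(x+δd_m)+ξ_m⁺ − f(x−δd_m) − ξ_m⁻)/(2δ)` satisfies, coordinatewise,
`|E[ĝ_i] − ∂_i f(x)| ≤ C₀ δ²` with `C₀ = α₀ N³ 3^{N−1}`. -/
theorem oneRDSA_lex_dp_gradient_estimate_bias (N : ℕ) (hN : 1 ≤ N)
    (f : (Fin N → ℝ) → ℝ) (α₀ : ℝ) (hα : 0 < α₀) (hf : ContDiff ℝ 3 f)
    (hbound : ∀ (x : Fin N → ℝ) (i j k : Fin N),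
      |iteratedFDeriv ℝ 3 f x ![Pi.single i 1, Pi.single j 1, Pi.single k 1]| ≤ α₀)
    (x : Fin N → ℝ) (δ : ℝ) (hδ : 0 < δ)
    {Ω : Type*} [MeasureSpace Ω] [IsProbabilityMeasure (volume : Measure Ω)]
    (ξp ξm : ℕ → Ω → ℝ)
    (hintp : ∀ m < 3 ^ N, Integrable (ξp m)) (hintm : ∀ m < 3 ^ N, Integrable (ξm m))
    (hmean : ∀ m < 3 ^ N, (∫ ω, (ξp m ω - ξm m ω)) = 0)
    (ghat : Ω → (Fin N → ℝ))
    (hg : ∀ ω, ghat ω = (1 / (2 * 3 ^ N : ℝ)) •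
      ∑ m ∈ Finset.range (3 ^ N),
        (((f (x + δ • fun j : Fin N => Dlex N m j) + ξp m ω -
            f (x - δ • fun j : Fin N => Dlex N m j) - ξm m ω) / (2 * δ)) •
          fun j : Fin N => Dlex N m j))
    (i : Fin N) :
    |(∫ ω, ghat ω i) - fderiv ℝ f x (Pi.single i 1)| ≤
      (α₀ * N ^ 3 * 3 ^ (N - 1)) * δ ^ 2 := by
  have hexp : ∫ ω, ghat ω i = 1 / (2 * 3 ^ N : ℝ) * ∑ m ∈ range (3 ^ N),
      (f (x + δ • fun j : Fin N => Dlex N m j) - f (x - δ • fun j : Fin N => Dlex N m j)) /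
        (2 * δ) * Dlex N m i := by
    have hgi (ω : Ω) : ghat ω i = 1 / (2 * 3 ^ N : ℝ) * ∑ m ∈ range (3 ^ N),
        ((f (x + δ • fun j : Fin N => Dlex N m j) - f (x - δ • fun j : Fin N => Dlex N m j)) /
          (2 * δ) * Dlex N m i + (ξp m ω - ξm m ω) * (Dlex N m i / (2 * δ))) := by
      rw [hg, Pi.smul_apply, Finset.sum_apply, smul_eq_mul]
      congr 1
      refine sum_congr rfl fun m _ => ?_
      rw [Pi.smul_apply, smul_eq_mul]
      ring
    have hnoise (m : ℕ) (hm : m ∈ range (3 ^ N)) :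
        Integrable fun ω => (ξp m ω - ξm m ω) * (Dlex N m i / (2 * δ)) :=
      ((hintp m (mem_range.1 hm)).sub (hintm m (mem_range.1 hm))).mul_const _
    simp_rw [hgi]
    rw [integral_const_mul,
      integral_finsetSum _ fun m hm => by exact (integrable_const _).add (hnoise m hm)]
    congr 1
    refine sum_congr rfl fun m hm => ?_
    rw [integral_add (integrable_const _) (hnoise m hm), integral_const,
      integral_mul_const, hmean m (mem_range.1 hm)]
    simp
  have hpow : (0 : ℝ) < 2 * 3 ^ N := by positivity
  have hlin : fderiv ℝ f x (Pi.single i 1) = 1 / (2 * 3 ^ N : ℝ) * ∑ m ∈ range (3 ^ N),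
      fderiv ℝ f x (fun j : Fin N => Dlex N m j) * Dlex N m i := by
    rw [sum_Dlex_smul_map]
    field_simp
  have hterm (m : ℕ) :
      |((f (x + δ • fun j : Fin N => Dlex N m j) - f (x - δ • fun j : Fin N => Dlex N m j)) /
        (2 * δ) - fderiv ℝ f x (fun j : Fin N => Dlex N m j)) * Dlex N m i| ≤
      α₀ * (2 * N) ^ 3 * δ ^ 2 / 6 * |Dlex N m i| := by
    rw [abs_mul]
    refine mul_le_mul_of_nonneg_right ?_ (abs_nonneg _)
    refine (abs_central_diff_sub_fderiv_le hf hbound x _ hδ).trans ?_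
    have hsum : ∑ j : Fin N, |Dlex N m j| ≤ 2 * N := by
      refine (sum_le_card_nsmul _ _ 2 fun j _ => abs_Dlex_le m j.2).trans_eq ?_
      simp [mul_comm]
    gcongr
  rw [hexp, hlin, ← mul_sub, ← sum_sub_distrib, abs_mul, abs_of_pos (by positivity)]
  simp_rw [← sub_mul]
  calc _ ≤ 1 / (2 * 3 ^ N : ℝ) * ∑ m ∈ range (3 ^ N),
        α₀ * (2 * N) ^ 3 * δ ^ 2 / 6 * |Dlex N m i| := by
        gcongr
        exact (abs_sum_le_sum_abs _ _).trans (sum_le_sum fun m _ => hterm m)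
    _ = 8 / 9 * (α₀ * N ^ 3 * δ ^ 2) := by
        rw [← mul_sum, sum_abs_Dlex i.2]
        field_simp
        ring
    _ ≤ 3 ^ (N - 1) * (α₀ * N ^ 3 * δ ^ 2) := by
        gcongr
        exact (by norm_num : (8 / 9 : ℝ) ≤ 1).trans (one_le_pow₀ (by norm_num))
    _ = _ := by ring
end
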